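/- Let τ belong to class 𝒯 with unique absolutely continuous invariant probability measure μ. Then the correlations decay exponentially for observables of bounded variation: there exist constants C > 0 and 0 < q < 1 such that for all f, g ∈ BV_I and all n ∈ ℕ, | ∫_I f·(g∘τ^n) dμ − (∫_I f dμ)(∫_I g dμ) | ≤ C·‖f‖_BV·‖g‖_BV·q^n. -/

import Mathlib

open Set Filter MeasureTheory Topology

structure PCT where
  τ : ℝ → ℝ
  a : ℕ → ℝ
  b : ℕ → ℝ
  da : ℕ → ℝ
  maps_to : Set.MapsTo τ (Set.Icc 0 1) (Set.Icc 0 1)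
  lt : ∀ i, a i < b i
  sub : ∀ i, Set.Ioo (a i) (b i) ⊆ Set.Icc (0:ℝ) 1
  disj : Pairwise (Function.onFun Disjoint fun i => Set.Ioo (a i) (b i))
  null : volume (Set.Icc (0:ℝ) 1 \ ⋃ i, Set.Ioo (a i) (b i)) = 0
  mono : ∀ i, StrictMonoOn τ (Set.Ioo (a i) (b i))
  conv : ∀ i, ConvexOn ℝ (Set.Ioo (a i) (b i)) τ
  diff : ∀ i, ∀ x ∈ Set.Ioo (a i) (b i), DifferentiableAt ℝ τ x
  lim_zero : ∀ i, Filter.Tendsto τ (nhdsWithin (a i) (Set.Ioi (a i))) (nhds 0)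
  deriv_lim : ∀ i, Filter.Tendsto (deriv τ) (nhdsWithin (a i) (Set.Ioi (a i))) (nhds (da i))
  da_pos : ∀ i, 0 < da i
  sum_inv : Summable (fun i => 1 / da i)
  expand : (¬ AccPt (0:ℝ) (Filter.principal (Set.range a))) → ∃ i, a i = 0 ∧ 1 < da i

/-- The interval `(c,d)` follows a single sequence of branches under the first `n`
iterates of `τ`. -/
def IsBranchSeq (T : PCT) (n : ℕ) (c d : ℝ) : Prop :=
  c < d ∧ ∀ k < n, ∃ i, T.τ^[k] '' Set.Ioo c d ⊆ Set.Ioo (T.a i) (T.b i)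

/-- `(c,d)` is a maximal open interval on which `τ^n` is a single monotone branch,
i.e. an element of the partition `𝒫⁽ⁿ⁾`. -/
def IsBranchInterval (T : PCT) (n : ℕ) (c d : ℝ) : Prop :=
  IsBranchSeq T n c d ∧
    ∀ c' d', c' ≤ c → d ≤ d' → IsBranchSeq T n c' d' → c' = c ∧ d' = d

namespace PCT

variable (T : PCT)

lemma Ioo_subset_Ioo_zero_one (i : ℕ) : Ioo (T.a i) (T.b i) ⊆ Ioo 0 1 := by
  simpa using (isOpen_Ioo.subset_interior_iff (t := Icc (0 : ℝ) 1)).2 (T.sub i)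

lemma a_nonneg (i : ℕ) : 0 ≤ T.a i :=
  ((Ioo_subset_Ioo_iff (T.lt i)).1 (T.Ioo_subset_Ioo_zero_one i)).1

lemma b_le_one (i : ℕ) : T.b i ≤ 1 :=
  ((Ioo_subset_Ioo_iff (T.lt i)).1 (T.Ioo_subset_Ioo_zero_one i)).2

lemma monotoneOn_deriv (i : ℕ) : MonotoneOn (deriv T.τ) (Ioo (T.a i) (T.b i)) :=
  (T.conv i).monotoneOn_deriv (T.diff i)

lemma da_le_deriv {i : ℕ} {x : ℝ} (hx : x ∈ Ioo (T.a i) (T.b i)) :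
    T.da i ≤ deriv T.τ x := by
  refine le_of_tendsto (T.deriv_lim i) ?_
  filter_upwards [Ioo_mem_nhdsGT hx.1] with y hy
  exact T.monotoneOn_deriv i ⟨hy.1, hy.2.trans hx.2⟩ hx hy.2.le

lemma deriv_pos {i : ℕ} {x : ℝ} (hx : x ∈ Ioo (T.a i) (T.b i)) : 0 < deriv T.τ x :=
  (T.da_pos i).trans_le (T.da_le_deriv hx)

lemma da_mul_sub_le {i : ℕ} {x : ℝ} (hx : x ∈ Ioo (T.a i) (T.b i)) :
    T.da i * (x - T.a i) ≤ T.τ x := by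
  have h1 : Tendsto (fun y => deriv T.τ y * (x - y) + T.τ y) (𝓝[>] (T.a i))
      (𝓝 (T.da i * (x - T.a i) + 0)) := by
    refine ((T.deriv_lim i).mul (tendsto_const_nhds.sub ?_)).add (T.lim_zero i)
    exact tendsto_nhdsWithin_of_tendsto_nhds tendsto_id
  rw [add_zero] at h1
  refine le_of_tendsto h1 ?_
  filter_upwards [Ioo_mem_nhdsGT hx.1] with y hy
  have hy' : y ∈ Ioo (T.a i) (T.b i) := ⟨hy.1, hy.2.trans hx.2⟩
  have := (T.conv i).deriv_le_slope hy' hx hy.2 (T.diff i y hy')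
  rw [slope_def_field, le_div_iff₀ (sub_pos.2 hy.2)] at this
  linarith

lemma τ_mem_Ioo {i : ℕ} {x : ℝ} (hx : x ∈ Ioo (T.a i) (T.b i)) : T.τ x ∈ Ioo 0 1 := by
  refine ⟨(mul_pos (T.da_pos i) (sub_pos.2 hx.1)).trans_le (T.da_mul_sub_le hx), ?_⟩
  obtain ⟨y, hxy, hyb⟩ := exists_between hx.2
  have hy : y ∈ Ioo (T.a i) (T.b i) := ⟨hx.1.trans hxy, hyb⟩
  exact (T.mono i hx hy hxy).trans_le (T.maps_to (T.sub i hy)).2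

/-- The image of the `i`-th branch. -/
def branchImage (i : ℕ) : Set ℝ := T.τ '' Ioo (T.a i) (T.b i)

lemma branchImage_subset (i : ℕ) : T.branchImage i ⊆ Ioo 0 1 := by
  rintro _ ⟨x, hx, rfl⟩
  exact T.τ_mem_Ioo hx

lemma mem_branchImage_of_le {i : ℕ} {y z : ℝ} (hy : y ∈ T.branchImage i) (hz : 0 < z)
    (hzy : z ≤ y) : z ∈ T.branchImage i := by
  obtain ⟨x, hx, rfl⟩ := hy
  have h := ((T.lim_zero i).eventually (gt_mem_nhds hz)).and (Ioo_mem_nhdsGT hx.1)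
  obtain ⟨x', hx'z, hx'⟩ := h.exists
  have hsub : Icc x' x ⊆ Ioo (T.a i) (T.b i) :=
    fun w hw => ⟨hx'.1.trans_le hw.1, hw.2.trans_lt hx.2⟩
  obtain ⟨w, hw, rfl⟩ := intermediate_value_Icc hx'.2.le
    (fun w hw => (T.diff i w (hsub hw)).continuousAt.continuousWithinAt) ⟨hx'z.le, hzy⟩
  exact ⟨w, hsub hw, rfl⟩

/-- The inverse of the `i`-th branch. -/
noncomputable def branchInv (i : ℕ) : ℝ → ℝ := Function.invFunOn T.τ (Ioo (T.a i) (T.b i))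

lemma branchInv_mem {i : ℕ} {y : ℝ} (hy : y ∈ T.branchImage i) :
    T.branchInv i y ∈ Ioo (T.a i) (T.b i) := Function.invFunOn_mem hy

lemma τ_branchInv {i : ℕ} {y : ℝ} (hy : y ∈ T.branchImage i) :
    T.τ (T.branchInv i y) = y := Function.invFunOn_eq hy

lemma branchInv_τ {i : ℕ} {x : ℝ} (hx : x ∈ Ioo (T.a i) (T.b i)) :
    T.branchInv i (T.τ x) = x := (T.mono i).injOn.leftInvOn_invFunOn hx

lemma branchInv_mono {i : ℕ} {y z : ℝ} (hy : y ∈ T.branchImage i) (hz : z ∈ T.branchImage i)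
    (h : y ≤ z) : T.branchInv i y ≤ T.branchInv i z := by
  rwa [← (T.mono i).le_iff_le (T.branchInv_mem hy) (T.branchInv_mem hz), T.τ_branchInv hy,
    T.τ_branchInv hz]

/-- The Jacobian of the inverse of the `i`-th branch, extended by zero. -/
noncomputable def weight (i : ℕ) : ℝ → ℝ :=
  (T.branchImage i).indicator fun y => (deriv T.τ (T.branchInv i y))⁻¹

/-- The contribution of the `i`-th branch to the transfer operator. -/
noncomputable def branchTerm (i : ℕ) (u : ℝ → ℝ) (x : ℝ) : ℝ :=
  T.weight i x * u (T.branchInv i x)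

/-- The transfer (Frobenius-Perron) operator. -/
noncomputable def transfer (u : ℝ → ℝ) (x : ℝ) : ℝ := ∑' i, T.branchTerm i u x

end PCT

/-- `u` is nonincreasing on `(0,1)` with values in `[0,B]`. -/
def IsDec (B : ℝ) (u : ℝ → ℝ) : Prop :=
  AntitoneOn u (Ioo 0 1) ∧ ∀ x ∈ Ioo (0 : ℝ) 1, u x ∈ Icc 0 B

namespace IsDec

variable {B C : ℝ} {u v : ℝ → ℝ}

lemma bound_nonneg (hu : IsDec B u) : 0 ≤ B := by
  have := hu.2 (1 / 2) (by norm_num)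
  exact this.1.trans this.2

lemma add (hu : IsDec B u) (hv : IsDec C v) : IsDec (B + C) (fun x => u x + v x) :=
  ⟨hu.1.add hv.1, fun x hx =>
    ⟨add_nonneg (hu.2 x hx).1 (hv.2 x hx).1, add_le_add (hu.2 x hx).2 (hv.2 x hx).2⟩⟩

lemma const_mul (hu : IsDec B u) {c : ℝ} (hc : 0 ≤ c) : IsDec (c * B) (fun x => c * u x) :=
  ⟨fun _ hx _ hy h => mul_le_mul_of_nonneg_left (hu.1 hx hy h) hc, fun x hx =>
    ⟨mul_nonneg hc (hu.2 x hx).1, mul_le_mul_of_nonneg_left (hu.2 x hx).2 hc⟩⟩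

lemma mul (hu : IsDec B u) (hv : IsDec C v) : IsDec (B * C) (fun x => u x * v x) :=
  ⟨fun x hx y hy h => mul_le_mul (hu.1 hx hy h) (hv.1 hx hy h) (hv.2 y hy).1 (hu.2 x hx).1,
    fun x hx => ⟨mul_nonneg (hu.2 x hx).1 (hv.2 x hx).1,
      mul_le_mul (hu.2 x hx).2 (hv.2 x hx).2 (hv.2 x hx).1 hu.bound_nonneg⟩⟩

lemma of_le (hu : IsDec B u) (h : ∀ x ∈ Ioo (0 : ℝ) 1, u x ≤ C) : IsDec C u :=
  ⟨hu.1, fun x hx => ⟨(hu.2 x hx).1, h x hx⟩⟩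

lemma mono (hu : IsDec B u) (h : B ≤ C) : IsDec C u :=
  hu.of_le fun x hx => (hu.2 x hx).2.trans h

lemma const (hB : 0 ≤ B) : IsDec B (fun _ => B) :=
  ⟨fun _ _ _ _ _ => le_rfl, fun _ _ => ⟨hB, le_rfl⟩⟩

lemma tsum {t : ℕ → ℝ → ℝ} {c : ℕ → ℝ} (ht : ∀ i, IsDec (c i) (t i)) (hc : Summable c) :
    IsDec (∑' i, c i) (fun x => ∑' i, t i x) := by
  have hs : ∀ x ∈ Ioo (0 : ℝ) 1, Summable fun i => t i x := fun x hx =>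
    Summable.of_nonneg_of_le (fun i => ((ht i).2 x hx).1) (fun i => ((ht i).2 x hx).2) hc
  exact ⟨fun x hx y hy h => (hs y hy).tsum_le_tsum (fun i => (ht i).1 hx hy h) (hs x hx),
    fun x hx => ⟨tsum_nonneg fun i => ((ht i).2 x hx).1,
      (hs x hx).tsum_le_tsum (fun i => ((ht i).2 x hx).2) hc⟩⟩

lemma aestronglyMeasurable (hu : IsDec B u) :
    AEStronglyMeasurable u (volume.restrict (Ioo 0 1)) :=
  (aemeasurable_restrict_of_antitoneOn measurableSet_Ioo hu.1).aestronglyMeasurable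

lemma abs_le (hu : IsDec B u) {x : ℝ} (hx : x ∈ Ioo (0 : ℝ) 1) : |u x| ≤ B := by
  rw [abs_of_nonneg (hu.2 x hx).1]
  exact (hu.2 x hx).2

end IsDec

lemma integrableOn_Ioo_of_abs_le {u : ℝ → ℝ} {B : ℝ}
    (hm : AEStronglyMeasurable u (volume.restrict (Ioo (0 : ℝ) 1)))
    (hB : ∀ x ∈ Ioo (0 : ℝ) 1, |u x| ≤ B) : IntegrableOn u (Ioo 0 1) :=
  IntegrableOn.of_bound (by simp) hm B
    ((ae_restrict_iff' measurableSet_Ioo).2 (ae_of_all _ hB))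

lemma abs_setIntegral_Ioo_le {u : ℝ → ℝ} {B : ℝ}
    (hB : ∀ x ∈ Ioo (0 : ℝ) 1, |u x| ≤ B) : |∫ x in Ioo (0 : ℝ) 1, u x| ≤ B := by
  simpa using norm_setIntegral_le_of_norm_le_const (μ := volume) (f := u)
    (s := Ioo (0 : ℝ) 1) (by simp) hB

namespace IsDec

variable {B : ℝ} {u : ℝ → ℝ}

lemma integrableOn (hu : IsDec B u) : IntegrableOn u (Ioo 0 1) :=
  integrableOn_Ioo_of_abs_le hu.aestronglyMeasurable fun _ hx => hu.abs_le hx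

lemma integrableOn_mul (hu : IsDec B u) {g : ℝ → ℝ} {C : ℝ}
    (hg : AEStronglyMeasurable g (volume.restrict (Ioo 0 1)))
    (hC : ∀ x ∈ Ioo (0 : ℝ) 1, |g x| ≤ C) : IntegrableOn (fun x => u x * g x) (Ioo 0 1) :=
  integrableOn_Ioo_of_abs_le (hu.aestronglyMeasurable.mul hg) (B := B * C) fun x hx => by
    rw [abs_mul]
    exact mul_le_mul (hu.abs_le hx) (hC x hx) (abs_nonneg _) hu.bound_nonneg

lemma integral_nonneg (hu : IsDec B u) : 0 ≤ ∫ x in Ioo (0 : ℝ) 1, u x :=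
  setIntegral_nonneg measurableSet_Ioo fun x hx => (hu.2 x hx).1

lemma integral_le (hu : IsDec B u) : ∫ x in Ioo (0 : ℝ) 1, u x ≤ B :=
  (le_abs_self _).trans (abs_setIntegral_Ioo_le fun _ hx => hu.abs_le hx)

lemma mul_le_integral (hu : IsDec B u) {x : ℝ} (hx : x ∈ Ioo (0 : ℝ) 1) :
    x * u x ≤ ∫ x in Ioo (0 : ℝ) 1, u x := by
  have hsub : Ioo 0 x ⊆ Ioo (0 : ℝ) 1 := Ioo_subset_Ioo_right hx.2.le
  calc x * u x = ∫ _ in Ioo 0 x, u x := by simp [hx.1.le]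
    _ ≤ ∫ y in Ioo 0 x, u y :=
      setIntegral_mono_on (integrableOn_const (by simp)) (hu.integrableOn.mono_set hsub)
        measurableSet_Ioo fun y hy => hu.1 (hsub hy) hx hy.2.le
    _ ≤ ∫ y in Ioo (0 : ℝ) 1, u y :=
      setIntegral_mono_set hu.integrableOn ((ae_restrict_iff' measurableSet_Ioo).2
        (ae_of_all _ fun y hy => (hu.2 y hy).1)) hsub.eventuallyLE

lemma integral_le_mul_add (hu : IsDec B u) {x : ℝ} (hx : x ∈ Ioo (0 : ℝ) 1) :
    ∫ y in Ioo (0 : ℝ) 1, u y ≤ B * x + u x := by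
  have hsub : Ioo 0 x ⊆ Ioo (0 : ℝ) 1 := Ioo_subset_Ioo_right hx.2.le
  have hi : IntegrableOn ((Ioo 0 x).indicator fun _ => B) (Ioo 0 1) :=
    (integrableOn_const (by simp)).indicator measurableSet_Ioo
  have hc : IntegrableOn (fun _ => u x) (Ioo (0 : ℝ) 1) := integrableOn_const (by simp)
  calc ∫ y in Ioo (0 : ℝ) 1, u y
      ≤ ∫ y in Ioo (0 : ℝ) 1, ((Ioo 0 x).indicator (fun _ => B) y + u x) := by
        refine setIntegral_mono_on hu.integrableOn (hi.add hc) measurableSet_Ioo fun y hy => ?_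
        by_cases hyx : y < x
        · rw [indicator_of_mem (show y ∈ Ioo 0 x from ⟨hy.1, hyx⟩)]
          linarith [(hu.2 y hy).2, (hu.2 x hx).1]
        · rw [indicator_of_notMem (fun h => hyx h.2), zero_add]
          exact hu.1 hx hy (not_lt.1 hyx)
    _ = B * x + u x := by
        rw [integral_add hi hc, setIntegral_indicator measurableSet_Ioo,
          inter_eq_self_of_subset_right hsub]
        simp [hx.1.le, mul_comm]

end IsDec

namespace PCT

variable (T : PCT) {B C : ℝ} {u v g : ℝ → ℝ}

lemma weight_of_mem {i : ℕ} {y : ℝ} (hy : y ∈ T.branchImage i) :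
    T.weight i y = (deriv T.τ (T.branchInv i y))⁻¹ := indicator_of_mem hy _

lemma branchTerm_of_notMem {i : ℕ} {y : ℝ} (hy : y ∉ T.branchImage i) :
    T.branchTerm i u y = 0 := by
  rw [branchTerm, weight, indicator_of_notMem hy, zero_mul]

lemma weight_nonneg (i : ℕ) (y : ℝ) : 0 ≤ T.weight i y :=
  indicator_nonneg (fun _ hy => (inv_pos.2 (T.deriv_pos (T.branchInv_mem hy))).le) _

lemma weight_le (i : ℕ) (y : ℝ) : T.weight i y ≤ (T.da i)⁻¹ :=
  indicator_le' (fun _ hy => inv_anti₀ (T.da_pos i) (T.da_le_deriv (T.branchInv_mem hy)))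
    (fun _ _ => (inv_pos.2 (T.da_pos i)).le) y

lemma summable_inv_da : Summable fun i => (T.da i)⁻¹ := by
  simpa only [one_div] using T.sum_inv

/-- The contribution of a single branch is monotone in the sense of `IsDec`; only the values of
`u` on the branch interval matter. -/
lemma isDec_branchTerm {i : ℕ} (hu : AntitoneOn u (Ioo (T.a i) (T.b i)))
    (hB : ∀ x ∈ Ioo (T.a i) (T.b i), u x ∈ Icc 0 B) :
    IsDec ((T.da i)⁻¹ * B) (T.branchTerm i u) := by
  have hB0 : 0 ≤ B := by
    obtain ⟨x, hx⟩ := nonempty_Ioo.2 (T.lt i)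
    exact (hB x hx).1.trans (hB x hx).2
  have hnonneg : ∀ x, 0 ≤ T.branchTerm i u x := by
    intro x
    by_cases hx : x ∈ T.branchImage i
    · exact mul_nonneg (T.weight_nonneg i x) (hB _ (T.branchInv_mem hx)).1
    · rw [T.branchTerm_of_notMem hx]
  refine ⟨fun x hx y _ hxy => ?_, fun x _ => ⟨hnonneg x, ?_⟩⟩
  · by_cases hyi : y ∈ T.branchImage i
    · have hxi := T.mem_branchImage_of_le hyi hx.1 hxy
      have hinv := T.branchInv_mono hxi hyi hxy
      have hx' := T.branchInv_mem hxi
      have hy' := T.branchInv_mem hyi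
      refine mul_le_mul ?_ (hu hx' hy' hinv) (hB _ hy').1 (T.weight_nonneg i x)
      rw [T.weight_of_mem hxi, T.weight_of_mem hyi]
      exact inv_anti₀ (T.deriv_pos hx') (T.monotoneOn_deriv i hx' hy' hinv)
    · rw [T.branchTerm_of_notMem hyi]
      exact hnonneg x
  · by_cases hx : x ∈ T.branchImage i
    · have hx' := hB _ (T.branchInv_mem hx)
      exact mul_le_mul (T.weight_le i x) hx'.2 hx'.1 (inv_pos.2 (T.da_pos i)).le
    · rw [T.branchTerm_of_notMem hx]
      exact mul_nonneg (inv_pos.2 (T.da_pos i)).le hB0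

lemma _root_.IsDec.branchTerm (hu : IsDec B u) (i : ℕ) :
    IsDec ((T.da i)⁻¹ * B) (T.branchTerm i u) :=
  T.isDec_branchTerm (hu.1.mono (T.Ioo_subset_Ioo_zero_one i))
    fun x hx => hu.2 x (T.Ioo_subset_Ioo_zero_one i hx)

lemma _root_.IsDec.transfer (hu : IsDec B u) :
    IsDec (∑' i, (T.da i)⁻¹ * B) (T.transfer u) :=
  IsDec.tsum (fun i => hu.branchTerm T i) (T.summable_inv_da.mul_right B)

lemma summable_branchTerm (hB : ∀ x ∈ Ioo (0 : ℝ) 1, |u x| ≤ B) (x : ℝ) :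
    Summable fun i => T.branchTerm i u x := by
  refine Summable.of_norm_bounded (T.summable_inv_da.mul_right |B|) fun i => ?_
  by_cases hx : x ∈ T.branchImage i
  · rw [PCT.branchTerm, norm_mul, Real.norm_of_nonneg (T.weight_nonneg i x)]
    exact mul_le_mul (T.weight_le i x) ((hB _ (T.Ioo_subset_Ioo_zero_one i
      (T.branchInv_mem hx))).trans (le_abs_self B)) (norm_nonneg _) (inv_pos.2 (T.da_pos i)).le
  · rw [T.branchTerm_of_notMem hx, norm_zero]
    exact mul_nonneg (inv_pos.2 (T.da_pos i)).le (abs_nonneg B)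

lemma transfer_add (hu : IsDec B u) (hv : IsDec C v) :
    T.transfer (fun x => u x + v x) = fun x => T.transfer u x + T.transfer v x := by
  funext x
  rw [transfer, transfer, transfer, ← (T.summable_branchTerm (fun _ => hu.abs_le) x).tsum_add
    (T.summable_branchTerm (fun _ => hv.abs_le) x)]
  exact tsum_congr fun i => mul_add _ _ _

lemma transfer_const_mul (c : ℝ) (u : ℝ → ℝ) :
    T.transfer (fun x => c * u x) = fun x => c * T.transfer u x := by
  funext x
  rw [transfer, transfer, ← tsum_mul_left]
  exact tsum_congr fun i => mul_left_comm _ _ _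

/-! ### Duality between the transfer operator and composition with `τ` -/

lemma deriv_smul_branchTerm_τ {i : ℕ} {x : ℝ} (hx : x ∈ Ioo (T.a i) (T.b i)) :
    |deriv T.τ x| • (T.branchTerm i u (T.τ x) * g (T.τ x)) = u x * g (T.τ x) := by
  have hpos := T.deriv_pos hx
  rw [branchTerm, T.weight_of_mem ⟨x, hx, rfl⟩, T.branchInv_τ hx, abs_of_pos hpos, smul_eq_mul]
  field_simp

lemma integrableOn_mul_comp_branch (hu : IsDec B u) (i : ℕ)
    (hg : AEStronglyMeasurable g (volume.restrict (Ioo 0 1)))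
    (hC : ∀ x ∈ Ioo (0 : ℝ) 1, |g x| ≤ C) :
    IntegrableOn (fun x => u x * g (T.τ x)) (Ioo (T.a i) (T.b i)) := by
  have h := ((hu.branchTerm T i).integrableOn_mul hg hC).mono_set (T.branchImage_subset i)
  rw [branchImage, integrableOn_image_iff_integrableOn_abs_deriv_smul measurableSet_Ioo
    (fun x hx => (T.diff i x hx).hasDerivAt.hasDerivWithinAt) (T.mono i).injOn] at h
  exact h.congr_fun (fun x hx => T.deriv_smul_branchTerm_τ hx) measurableSet_Ioo

lemma setIntegral_branchTerm_mul (u g : ℝ → ℝ) (i : ℕ) :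
    ∫ x in Ioo (0 : ℝ) 1, T.branchTerm i u x * g x =
      ∫ x in Ioo (T.a i) (T.b i), u x * g (T.τ x) := by
  rw [setIntegral_eq_of_subset_of_forall_sdiff_eq_zero measurableSet_Ioo
    (T.branchImage_subset i) (fun x hx => by rw [T.branchTerm_of_notMem hx.2, zero_mul]),
    branchImage, integral_image_eq_integral_abs_deriv_smul measurableSet_Ioo
    (fun x hx => (T.diff i x hx).hasDerivAt.hasDerivWithinAt) (T.mono i).injOn]
  exact setIntegral_congr_fun measurableSet_Ioo fun x hx => T.deriv_smul_branchTerm_τ hx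

lemma iUnion_ae_eq : (⋃ i, Ioo (T.a i) (T.b i)) =ᵐ[volume] Ioo (0 : ℝ) 1 := by
  refine (iUnion_subset T.Ioo_subset_Ioo_zero_one).eventuallyLE.antisymm ?_
  refine ae_le_set.2 (measure_mono_null (sdiff_subset_sdiff_left Ioo_subset_Icc_self) T.null)

lemma restrict_iUnion :
    volume.restrict (⋃ i, Ioo (T.a i) (T.b i)) = volume.restrict (Ioo (0 : ℝ) 1) :=
  Measure.restrict_congr_set T.iUnion_ae_eq

lemma aestronglyMeasurable_comp_τ
    (hg : AEStronglyMeasurable g (volume.restrict (Ioo 0 1)))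
    (hC : ∀ x ∈ Ioo (0 : ℝ) 1, |g x| ≤ C) :
    AEStronglyMeasurable (fun x => g (T.τ x)) (volume.restrict (Ioo 0 1)) := by
  rw [← T.restrict_iUnion, aestronglyMeasurable_iUnion_iff]
  intro i
  simpa using (T.integrableOn_mul_comp_branch (IsDec.const zero_le_one) i
    hg hC).aestronglyMeasurable

/-- The transfer operator is dual to composition with `τ`. -/
lemma integral_transfer_mul (hu : IsDec B u)
    (hg : AEStronglyMeasurable g (volume.restrict (Ioo 0 1)))
    (hC : ∀ x ∈ Icc (0 : ℝ) 1, |g x| ≤ C) :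
    ∫ x in Ioo (0 : ℝ) 1, T.transfer u x * g x =
      ∫ x in Ioo (0 : ℝ) 1, u x * g (T.τ x) := by
  have hC' : ∀ x ∈ Ioo (0 : ℝ) 1, |g x| ≤ C := fun x hx => hC x (Ioo_subset_Icc_self hx)
  have hint : IntegrableOn (fun x => u x * g (T.τ x)) (Ioo 0 1) :=
    hu.integrableOn_mul (T.aestronglyMeasurable_comp_τ hg hC')
      fun x hx => hC _ (T.maps_to (Ioo_subset_Icc_self hx))
  have hsum : HasSum (fun i => ∫ x in Ioo (0 : ℝ) 1, T.branchTerm i u x * g x)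
      (∫ x in Ioo (0 : ℝ) 1, ∑' i, T.branchTerm i u x * g x) := by
    refine hasSum_integral_of_summable_integral_norm
      (fun i => (hu.branchTerm T i).integrableOn_mul hg hC') ?_
    refine Summable.of_nonneg_of_le (fun i => integral_nonneg fun x => norm_nonneg _)
      (fun i => ?_) ((T.summable_inv_da.mul_right B).mul_right C)
    refine (le_abs_self _).trans (abs_setIntegral_Ioo_le fun x hx => ?_)
    rw [abs_norm, norm_mul]
    exact mul_le_mul ((hu.branchTerm T i).abs_le hx) (hC' x hx) (norm_nonneg _)
        (hu.branchTerm T i).bound_nonneg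
  have hunion := hasSum_integral_iUnion (μ := volume) (f := fun x => u x * g (T.τ x))
    (fun i => measurableSet_Ioo) T.disj
    (hint.congr_set_ae T.iUnion_ae_eq)
  rw [T.restrict_iUnion] at hunion
  simp only [setIntegral_branchTerm_mul, tsum_mul_right] at hsum
  exact hsum.unique hunion

lemma integral_transfer (hu : IsDec B u) :
    ∫ x in Ioo (0 : ℝ) 1, T.transfer u x = ∫ x in Ioo (0 : ℝ) 1, u x := by
  simpa using T.integral_transfer_mul hu (g := fun _ => 1) (C := 1)
    aestronglyMeasurable_const (by simp)

end PCT

namespace PCT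

variable (T : PCT) {B C : ℝ} {u v g : ℝ → ℝ}

/-! ### The Lasota-Yorke inequality on nonincreasing functions -/

lemma b_le_a_of_le {i j : ℕ} (hij : i ≠ j) (h : T.a i ≤ T.a j) : T.b i ≤ T.a j := by
  have := Ioo_disjoint_Ioo.1 (T.disj hij)
  rw [max_eq_right h, min_le_iff] at this
  exact this.resolve_right (T.lt j).not_ge

lemma a_injective : Function.Injective T.a := fun i j h => by
  by_contra hij
  exact (T.lt i).not_ge (h ▸ T.b_le_a_of_le hij h.le)

lemma one_lt_da_of_a_eq_zero {i : ℕ} (hi : T.a i = 0) : 1 < T.da i := by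
  have hacc : ¬ AccPt (0 : ℝ) (𝓟 (range T.a)) := by
    rw [accPt_iff_nhds]
    intro h
    obtain ⟨_, ⟨hlt, j, rfl⟩, hj⟩ := h (Iio (T.b i)) (Iio_mem_nhds (hi ▸ T.lt i))
    have hij : i ≠ j := by
      rintro rfl
      exact hj hi
    exact (T.b_le_a_of_le hij (hi ▸ T.a_nonneg j)).not_gt hlt
  obtain ⟨j, hj, hj'⟩ := T.expand hacc
  rwa [T.a_injective (hi.trans hj.symm)]

lemma exists_finset_tail_lt_one : ∃ F : Finset ℕ, (∀ i ∈ F, 0 < T.a i) ∧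
    ∑' i, (if i ∈ F then 0 else (T.da i)⁻¹) < 1 := by
  obtain ⟨ρ, hρ, hsum⟩ : ∃ ρ : ℝ, ρ < 1 ∧
      ∀ s : Finset ℕ, ∑ i ∈ s with ¬ 0 < T.a i, (T.da i)⁻¹ ≤ ρ := by
    have hzero : ∀ {i}, ¬ 0 < T.a i → T.a i = 0 := fun h => le_antisymm (not_lt.1 h) (T.a_nonneg _)
    by_cases h : ∃ i, T.a i = 0
    · obtain ⟨i, hi⟩ := h
      refine ⟨(T.da i)⁻¹, inv_lt_one_of_one_lt₀ (T.one_lt_da_of_a_eq_zero hi), fun s => ?_⟩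
      rw [← Finset.sum_singleton (fun i => (T.da i)⁻¹) i]
      refine Finset.sum_le_sum_of_subset_of_nonneg (fun j hj => ?_)
        fun j _ _ => (inv_pos.2 (T.da_pos j)).le
      rw [Finset.mem_singleton]
      exact T.a_injective ((hzero (Finset.mem_filter.1 hj).2).trans hi.symm)
    · refine ⟨0, zero_lt_one, fun s => (Finset.sum_eq_zero fun j hj => ?_).le⟩
      exact (h ⟨j, hzero (Finset.mem_filter.1 hj).2⟩).elim
  obtain ⟨s, hs⟩ := (T.summable_inv_da.hasSum.eventually
    (lt_mem_nhds (show ∑' i, (T.da i)⁻¹ - (1 - ρ) < ∑' i, (T.da i)⁻¹ by linarith))).exists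
  refine ⟨s.filter (0 < T.a ·), fun i hi => (Finset.mem_filter.1 hi).2, ?_⟩
  set F := s.filter (0 < T.a ·)
  have hsplit : ∑ i ∈ F, (T.da i)⁻¹ + ∑' i, (if i ∈ F then 0 else (T.da i)⁻¹) =
      ∑' i, (T.da i)⁻¹ := by
    have h1 : HasSum (fun i => if i ∈ F then (T.da i)⁻¹ else 0) (∑ i ∈ F, (T.da i)⁻¹) := by
      have := hasSum_sum_of_ne_finset_zero (s := F) (L := SummationFilter.unconditional ℕ)
        (f := fun i => if i ∈ F then (T.da i)⁻¹ else 0) fun i hi => if_neg hi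
      rwa [Finset.sum_congr rfl fun i hi => if_pos hi] at this
    have h2 : (fun i => if i ∈ F then 0 else (T.da i)⁻¹) =
        fun i => (T.da i)⁻¹ - if i ∈ F then (T.da i)⁻¹ else 0 := by
      funext i
      split_ifs <;> simp
    rw [h2, T.summable_inv_da.tsum_sub h1.summable, h1.tsum_eq]
    ring
  have := Finset.sum_filter_add_sum_filter_not s (0 < T.a ·) fun i => (T.da i)⁻¹
  linarith [hsum s]

/-- The Lasota-Yorke inequality for nonincreasing functions, with constants `α` and `K`. -/
def LasotaYorke (α K : ℝ) : Prop :=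
  0 < α ∧ α < 1 ∧ 0 ≤ K ∧ ∀ (B : ℝ) (u : ℝ → ℝ), IsDec B u →
    IsDec (α * B + K * ∫ x in Ioo (0 : ℝ) 1, u x) (T.transfer u)

lemma exists_lasotaYorke : ∃ α K, T.LasotaYorke α K := by
  obtain ⟨F, hF, hlt⟩ := T.exists_finset_tail_lt_one
  set p : ℕ → ℝ := fun i => if i ∈ F then 0 else (T.da i)⁻¹ with hp
  set r : ℕ → ℝ := fun i => if i ∈ F then (T.da i)⁻¹ * (T.a i)⁻¹ else 0 with hr
  have hda : ∀ i, 0 < (T.da i)⁻¹ := fun i => inv_pos.2 (T.da_pos i)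
  have hps : Summable p := Summable.of_nonneg_of_le
    (fun i => by simp only [hp]; split_ifs; exacts [le_rfl, (hda i).le])
    (fun i => by simp only [hp]; split_ifs; exacts [(hda i).le, le_rfl]) T.summable_inv_da
  have hrs : Summable r := summable_of_ne_finset_zero (s := F) fun i hi => if_neg hi
  refine ⟨max (1 / 2) (∑' i, p i), ∑' i, r i, by positivity, max_lt (by norm_num) hlt,
    tsum_nonneg fun i => ?_, fun B u hu => (hu.transfer T).of_le fun x hx => ?_⟩
  · simp only [hr]
    split_ifs with hi
    exacts [(mul_pos (hda i) (inv_pos.2 (hF i hi))).le, le_rfl]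
  · set m := ∫ x in Ioo (0 : ℝ) 1, u x
    calc T.transfer u x ≤ ∑' i, (p i * B + r i * m) := by
          refine (T.summable_branchTerm (fun _ => hu.abs_le) x).tsum_le_tsum (fun i => ?_)
            ((hps.mul_right B).add (hrs.mul_right m))
          by_cases hi : i ∈ F
          · simp only [hp, hr, if_pos hi, zero_mul, zero_add]
            by_cases hxi : x ∈ T.branchImage i
            · have hy := T.branchInv_mem hxi
              have hy' := T.Ioo_subset_Ioo_zero_one i hy
              rw [mul_assoc]
              refine mul_le_mul (T.weight_le i x) ?_ (hu.2 _ hy').1 (hda i).le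
              rw [le_inv_mul_iff₀ (hF i hi)]
              exact (mul_le_mul_of_nonneg_right hy.1.le (hu.2 _ hy').1).trans
                (hu.mul_le_integral hy')
            · rw [T.branchTerm_of_notMem hxi]
              exact mul_nonneg (mul_pos (hda i) (inv_pos.2 (hF i hi))).le hu.integral_nonneg
          · simp only [hp, hr, if_neg hi, zero_mul, add_zero]
            exact ((hu.branchTerm T i).2 x hx).2
      _ = (∑' i, p i) * B + (∑' i, r i) * m := by
          rw [(hps.mul_right B).tsum_add (hrs.mul_right m), tsum_mul_right, tsum_mul_right]
      _ ≤ _ := by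
          gcongr
          exacts [hu.bound_nonneg, le_max_right _ _]

/-! ### Iterates of the transfer operator -/

variable {T} {α K : ℝ}

lemma LasotaYorke.isDec_iterate (h : T.LasotaYorke α K) (hu : IsDec B u) (n : ℕ) :
    IsDec (α ^ n * B + K / (1 - α) * ∫ x in Ioo (0 : ℝ) 1, u x) (T.transfer^[n] u) ∧
      ∫ x in Ioo (0 : ℝ) 1, T.transfer^[n] u x = ∫ x in Ioo (0 : ℝ) 1, u x := by
  obtain ⟨hα0, hα1, hK, hLY⟩ := h
  have hα : 0 < 1 - α := sub_pos.2 hα1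
  induction n with
  | zero =>
    refine ⟨hu.mono ?_, rfl⟩
    have := mul_nonneg (div_nonneg hK hα.le) hu.integral_nonneg
    linarith
  | succ n ih =>
    rw [Function.iterate_succ_apply', T.integral_transfer ih.1]
    refine ⟨(hLY _ _ ih.1).mono (le_of_eq ?_), ih.2⟩
    rw [ih.2]
    field_simp
    ring

lemma LasotaYorke.isDec_iterate_of_le (h : T.LasotaYorke α K) {M : ℝ} (hM : K / (1 - α) ≤ M)
    (hu : IsDec M u) (hu1 : ∫ x in Ioo (0 : ℝ) 1, u x = 1) (n : ℕ) :
    IsDec M (T.transfer^[n] u) := by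
  induction n with
  | zero => exact hu
  | succ n ih =>
    rw [Function.iterate_succ_apply']
    refine (h.2.2.2 _ _ ih).mono ?_
    rw [(h.isDec_iterate hu n).2, hu1]
    rw [div_le_iff₀ (sub_pos.2 h.2.1)] at hM
    linarith

variable (T)

lemma iterate_transfer_add (hu : IsDec B u) (hv : IsDec C v) (n : ℕ) :
    T.transfer^[n] (fun x => u x + v x) =
      fun x => T.transfer^[n] u x + T.transfer^[n] v x := by
  induction n generalizing B C u v with
  | zero => rfl
  | succ n ih =>
    simp only [Function.iterate_succ_apply]
    rw [T.transfer_add hu hv, ih (hu.transfer T) (hv.transfer T)]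

lemma iterate_transfer_const_mul (c : ℝ) (u : ℝ → ℝ) (n : ℕ) :
    T.transfer^[n] (fun x => c * u x) = fun x => c * T.transfer^[n] u x := by
  induction n generalizing u with
  | zero => rfl
  | succ n ih =>
    simp only [Function.iterate_succ_apply]
    rw [T.transfer_const_mul, ih]

lemma aestronglyMeasurable_comp_iterate
    (hg : AEStronglyMeasurable g (volume.restrict (Ioo 0 1)))
    (hC : ∀ x ∈ Icc (0 : ℝ) 1, |g x| ≤ C) (n : ℕ) :
    AEStronglyMeasurable (fun x => g (T.τ^[n] x)) (volume.restrict (Ioo 0 1)) := by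
  induction n with
  | zero => exact hg
  | succ n ih =>
    simp only [Function.iterate_succ_apply]
    exact T.aestronglyMeasurable_comp_τ ih
      fun x hx => hC _ (T.maps_to.iterate n (Ioo_subset_Icc_self hx))

lemma integral_iterate_transfer_mul (hu : IsDec B u)
    (hg : AEStronglyMeasurable g (volume.restrict (Ioo 0 1)))
    (hC : ∀ x ∈ Icc (0 : ℝ) 1, |g x| ≤ C) (n : ℕ) :
    ∫ x in Ioo (0 : ℝ) 1, T.transfer^[n] u x * g x =
      ∫ x in Ioo (0 : ℝ) 1, u x * g (T.τ^[n] x) := by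
  induction n generalizing B u with
  | zero => rfl
  | succ n ih =>
    simp only [Function.iterate_succ_apply]
    rw [ih (hu.transfer T)]
    exact T.integral_transfer_mul hu (T.aestronglyMeasurable_comp_iterate hg hC n)
      fun x hx => hC _ (T.maps_to.iterate n hx)

/-! ### Minorization -/

/-- If a branch interval lies in `(0,c)`, one application of the transfer operator produces a
common component. -/
lemma exists_minorant_of_branch {c v : ℝ} (hv : 0 < v) {i : ℕ} (hi : T.b i ≤ c)
    (hu : IsDec B u) (huv : ∀ x ∈ Ioo (0 : ℝ) 1, x < c → v ≤ u x) :
    ∃ B', IsDec B' (fun x => T.transfer u x - T.branchTerm i (fun _ => v) x) := by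
  set w : ℕ → ℝ → ℝ := fun j x => if j = i then u x - v else u x with hw
  have hdec : ∀ j, IsDec ((T.da j)⁻¹ * B) (T.branchTerm j (w j)) := fun j => by
    have hsub := T.Ioo_subset_Ioo_zero_one j
    by_cases hj : j = i
    · subst hj
      simp only [hw, if_true]
      refine T.isDec_branchTerm (fun x hx y hy hxy => sub_le_sub_right
        (hu.1 (hsub hx) (hsub hy) hxy) v) fun x hx => ?_
      have h1 := hu.2 x (hsub hx)
      have h2 := huv x (hsub hx) (hx.2.trans_le hi)
      exact ⟨sub_nonneg.2 h2, by linarith [h1.2]⟩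
    · simp only [hw, if_neg hj]
      exact hu.branchTerm T j
  refine ⟨∑' j, (T.da j)⁻¹ * B, ?_⟩
  convert IsDec.tsum hdec (T.summable_inv_da.mul_right B) using 2 with x
  have h1 : ∀ j, T.branchTerm j (w j) x =
      T.branchTerm j u x - if j = i then T.branchTerm i (fun _ => v) x else 0 := fun j => by
    by_cases hj : j = i
    · subst hj
      simp [hw, PCT.branchTerm, mul_sub]
    · simp [hw, hj]
  have h2 := hasSum_ite_eq i (T.branchTerm i (fun _ => v) x)
  rw [tsum_congr h1, (T.summable_branchTerm (fun _ => hu.abs_le) x).tsum_sub h2.summable,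
    h2.tsum_eq, transfer]

/-- The branch at zero spreads a lower bound near zero over a larger interval. -/
lemma le_transfer_of_a_eq_zero {c v : ℝ} (hc : 0 < c) (hv : 0 < v) {i : ℕ} (hi : T.a i = 0)
    (hci : c < T.b i) (hu : IsDec B u) (huv : ∀ x ∈ Ioo (0 : ℝ) 1, x < c → v ≤ u x) :
    ∀ x ∈ Ioo (0 : ℝ) 1, x < c * T.da i → (deriv T.τ c)⁻¹ * v ≤ T.transfer u x := by
  intro x hx hxc
  have hcm : c ∈ Ioo (T.a i) (T.b i) := ⟨hi ▸ hc, hci⟩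
  have hxτ : x < T.τ c := hxc.trans_le (by
    have := T.da_mul_sub_le hcm
    rw [hi] at this
    linarith)
  have hxi := T.mem_branchImage_of_le ⟨c, hcm, rfl⟩ hx.1 hxτ.le
  have hy := T.branchInv_mem hxi
  have hyc : T.branchInv i x < c := by
    rwa [← (T.mono i).lt_iff_lt hy hcm, T.τ_branchInv hxi]
  calc (deriv T.τ c)⁻¹ * v ≤ T.branchTerm i u x := by
        rw [PCT.branchTerm, T.weight_of_mem hxi]
        exact mul_le_mul (inv_anti₀ (T.deriv_pos hy) (T.monotoneOn_deriv i hy hcm hyc.le))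
          (huv _ (T.Ioo_subset_Ioo_zero_one i hy) hyc) hv.le (inv_pos.2 (T.deriv_pos hy)).le
    _ ≤ T.transfer u x :=
        (T.summable_branchTerm (fun _ => hu.abs_le) x).le_tsum i
          fun j _ => ((hu.branchTerm T j).2 x hx).1

/-- Nonincreasing functions bounded below by `v` on `(0,c)` acquire a common component after
finitely many applications of the transfer operator. -/
def HasMinorant (c v : ℝ) : Prop :=
  ∃ (n : ℕ) (k : ℝ → ℝ) (D : ℝ), IsDec D k ∧ 0 < ∫ x in Ioo (0 : ℝ) 1, k x ∧
    ∀ (B : ℝ) (u : ℝ → ℝ), IsDec B u → (∀ x ∈ Ioo (0 : ℝ) 1, x < c → v ≤ u x) →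
      ∃ B', IsDec B' (fun x => T.transfer^[n] u x - k x)

lemma hasMinorant_of_b_le {c v : ℝ} (hv : 0 < v) {i : ℕ} (hi : T.b i ≤ c) :
    T.HasMinorant c v := by
  refine ⟨1, T.branchTerm i fun _ => v, _, (IsDec.const hv.le).branchTerm T i, ?_,
    fun B u hu huv => T.exists_minorant_of_branch hv hi hu huv⟩
  have := T.setIntegral_branchTerm_mul (fun _ => v) (fun _ => 1) i
  simp only [mul_one] at this
  rw [this]
  simpa [(T.lt i).le] using mul_pos (sub_pos.2 (T.lt i)) hv

lemma hasMinorant_of_a_eq_zero {i : ℕ} (hi : T.a i = 0) (m : ℕ) {c v : ℝ} (hc : 0 < c)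
    (hv : 0 < v) (hm : 1 ≤ c * T.da i ^ m) : T.HasMinorant c v := by
  induction m generalizing c v with
  | zero => exact T.hasMinorant_of_b_le hv ((T.b_le_one i).trans (by simpa using hm))
  | succ m ih =>
    rcases le_or_gt (T.b i) c with hbc | hcb
    · exact T.hasMinorant_of_b_le hv hbc
    · have hderiv := T.deriv_pos (x := c) (i := i) ⟨hi ▸ hc, hcb⟩
      obtain ⟨n, k, D, hk, hkpos, h⟩ := ih (mul_pos hc (T.da_pos i))
        (mul_pos (inv_pos.2 hderiv) hv) (by rwa [mul_assoc, ← pow_succ'])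
      exact ⟨n + 1, k, D, hk, hkpos, fun B u hu huv =>
        h _ _ (hu.transfer T) (T.le_transfer_of_a_eq_zero hc hv hi hcb hu huv)⟩

lemma hasMinorant {c v : ℝ} (hc : 0 < c) (hv : 0 < v) : T.HasMinorant c v := by
  by_cases hacc : AccPt (0 : ℝ) (𝓟 (range T.a))
  · rw [accPt_iff_nhds] at hacc
    obtain ⟨_, ⟨hltc, i, rfl⟩, hi⟩ := hacc (Iio c) (Iio_mem_nhds hc)
    have hipos := (T.a_nonneg i).lt_of_ne' hi
    obtain ⟨_, ⟨hlt, j, rfl⟩, -⟩ := hacc (Iio (T.a i)) (Iio_mem_nhds hipos)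
    rw [mem_Iio] at hlt hltc
    exact T.hasMinorant_of_b_le hv
      ((T.b_le_a_of_le (fun h => hlt.ne (congrArg T.a h)) hlt.le).trans hltc.le)
  · obtain ⟨i, hi, hda⟩ := T.expand hacc
    obtain ⟨m, hm⟩ := pow_unbounded_of_one_lt (1 / c) hda
    rw [div_lt_iff₀' hc] at hm
    exact T.hasMinorant_of_a_eq_zero hi m hc hv hm.le

end PCT

namespace PCT

variable {T : PCT} {α K M : ℝ}

/-! ### Contraction -/

/-- Normalized nonincreasing functions bounded by `M` share a fixed fraction `κ` of their mass
after `N` applications of the transfer operator, and the remainders are of the same type. -/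
lemma LasotaYorke.exists_splitting (h : T.LasotaYorke α K) (hM : K / (1 - α) + 1 ≤ M) :
    ∃ (N : ℕ) (κ D : ℝ) (k : ℝ → ℝ), 0 < N ∧ 0 < κ ∧ κ < 1 ∧ IsDec D k ∧
      ∀ u, IsDec M u → ∫ x in Ioo (0 : ℝ) 1, u x = 1 →
        ∃ r, IsDec M r ∧ ∫ x in Ioo (0 : ℝ) 1, r x = 1 ∧
          T.transfer^[N] u = fun x => k x + (1 - κ) * r x := by
  have hK' : 0 ≤ K / (1 - α) := div_nonneg h.2.2.1 (sub_pos.2 h.2.1).le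
  have hM1 : 1 ≤ M := by linarith
  have hM0 : 0 < M := by linarith
  obtain ⟨n, k₀, D₀, hk₀, hk₀pos, hmin⟩ :=
    T.hasMinorant (c := 1 / (2 * M)) (v := 1 / 2) (by positivity) (by norm_num)
  have hlower : ∀ u, IsDec M u → ∫ x in Ioo (0 : ℝ) 1, u x = 1 →
      ∃ B', IsDec B' (fun x => T.transfer^[n] u x - k₀ x) := by
    refine fun u hu hu1 => hmin M u hu fun x hx hxc => ?_
    have h1 := hu.integral_le_mul_add hx
    rw [lt_div_iff₀ (by positivity)] at hxc
    linarith
  have hint : ∀ u, IsDec M u → ∫ x in Ioo (0 : ℝ) 1, u x = 1 →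
      ∫ x in Ioo (0 : ℝ) 1, (T.transfer^[n] u x - k₀ x) =
        1 - ∫ x in Ioo (0 : ℝ) 1, k₀ x := by
    intro u hu hu1
    have h1 := h.isDec_iterate hu n
    rw [integral_sub h1.1.integrableOn hk₀.integrableOn, h1.2, hu1]
  have hk₀le : ∫ x in Ioo (0 : ℝ) 1, k₀ x ≤ 1 := by
    have h1 : IsDec M (fun _ => (1 : ℝ)) := (IsDec.const zero_le_one).mono hM1
    obtain ⟨B', hB'⟩ := hlower _ h1 (by simp)
    have := hB'.integral_nonneg
    rw [hint _ h1 (by simp)] at this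
    linarith
  set κ := 1 / 2 * ∫ x in Ioo (0 : ℝ) 1, k₀ x with hκ
  have hκpos : 0 < κ := by positivity
  have hκhalf : κ ≤ 1 / 2 := by linarith
  set k : ℝ → ℝ := fun x => 1 / 2 * k₀ x with hk
  have hkdec : IsDec (1 / 2 * D₀) k := hk₀.const_mul (by norm_num)
  obtain ⟨m, hm⟩ := exists_pow_lt_of_lt_one (show 0 < 1 / (2 * (M + K / (1 - α))) by positivity)
    h.2.1
  rw [lt_div_iff₀ (by positivity)] at hm
  have hm' : α ^ (m + 1) * (2 * (M + K / (1 - α))) ≤ 1 :=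
    (mul_le_mul_of_nonneg_right (pow_le_pow_of_le_one h.1.le h.2.1.le m.le_succ)
      (by positivity)).trans hm.le
  refine ⟨m + 1 + n, κ, _, T.transfer^[m + 1] k, by omega, hκpos, by linarith,
    (h.isDec_iterate hkdec (m + 1)).1, fun u hu hu1 => ?_⟩
  obtain ⟨B', hB'⟩ := hlower u hu hu1
  have hPn := h.isDec_iterate hu n
  rw [hu1, mul_one] at hPn
  set s : ℝ → ℝ := fun x => (T.transfer^[n] u x - k₀ x) + k x with hs
  have hsdec : IsDec (M + K / (1 - α)) s := (hB'.add hkdec).of_le fun x hx => by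
    have h1 := (hPn.1.2 x hx).2
    have h2 := (hk₀.2 x hx).1
    have h3 : α ^ n * M ≤ M := mul_le_of_le_one_left hM0.le (pow_le_one₀ h.1.le h.2.1.le)
    simp only [hk]
    linarith
  have hsint : ∫ x in Ioo (0 : ℝ) 1, s x = 1 - κ := by
    rw [hs, integral_add hB'.integrableOn hkdec.integrableOn, hint u hu hu1, hk,
      integral_const_mul, hκ]
    ring
  have hPs := h.isDec_iterate hsdec (m + 1)
  rw [hsint] at hPs
  have hκ1 : 0 < 1 - κ := by linarith
  refine ⟨fun x => (1 - κ)⁻¹ * T.transfer^[m + 1] s x,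
    (hPs.1.const_mul (inv_pos.2 hκ1).le).mono ?_, ?_, ?_⟩
  · rw [inv_mul_le_iff₀ hκ1]
    nlinarith
  · rw [integral_const_mul, hPs.2, inv_mul_cancel₀ hκ1.ne']
  · have hsum : T.transfer^[n] u = fun x => k x + s x := by
      funext x
      simp only [hs, hk]
      ring
    rw [Function.iterate_add_apply, hsum, T.iterate_transfer_add hkdec hsdec]
    funext x
    rw [mul_inv_cancel_left₀ hκ1.ne']

lemma LasotaYorke.exists_contraction (h : T.LasotaYorke α K) (hM : K / (1 - α) + 1 ≤ M) :
    ∃ C q : ℝ, 0 < C ∧ 0 < q ∧ q < 1 ∧ ∀ u v, IsDec M u → IsDec M v →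
      ∫ x in Ioo (0 : ℝ) 1, u x = 1 → ∫ x in Ioo (0 : ℝ) 1, v x = 1 →
      ∀ n, ∀ x ∈ Ioo (0 : ℝ) 1,
        |T.transfer^[n] u x - T.transfer^[n] v x| ≤ C * q ^ n := by
  have hK' : 0 ≤ K / (1 - α) := div_nonneg h.2.2.1 (sub_pos.2 h.2.1).le
  have hM0 : 0 < M := by linarith
  obtain ⟨N, κ, D, k, hN, hκ0, hκ1, hk, hsplit⟩ := h.exists_splitting hM
  have hκ : 0 < 1 - κ := sub_pos.2 hκ1
  have hmul : ∀ j u v, IsDec M u → IsDec M v →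
      ∫ x in Ioo (0 : ℝ) 1, u x = 1 → ∫ x in Ioo (0 : ℝ) 1, v x = 1 →
      ∀ x ∈ Ioo (0 : ℝ) 1,
        |T.transfer^[N * j] u x - T.transfer^[N * j] v x| ≤ M * (1 - κ) ^ j := by
    intro j
    induction j with
    | zero =>
      intro u v hu hv _ _ x hx
      have h1 := hu.2 x hx
      have h2 := hv.2 x hx
      simp only [mul_zero, Function.iterate_zero, id, pow_zero, mul_one]
      rw [_root_.abs_le]
      constructor <;> linarith [h1.1, h1.2, h2.1, h2.2]
    | succ j ih =>
      intro u v hu hv hu1 hv1 x hx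
      obtain ⟨r, hr, hr1, hur⟩ := hsplit u hu hu1
      obtain ⟨s, hs, hs1, hvs⟩ := hsplit v hv hv1
      rw [Nat.mul_succ, Function.iterate_add_apply, Function.iterate_add_apply, hur, hvs,
        T.iterate_transfer_add hk (hr.const_mul hκ.le),
        T.iterate_transfer_add hk (hs.const_mul hκ.le), T.iterate_transfer_const_mul,
        T.iterate_transfer_const_mul, add_sub_add_left_eq_sub, ← mul_sub, abs_mul,
        abs_of_pos hκ, pow_succ, ← mul_assoc, mul_comm]
      exact mul_le_mul_of_nonneg_right (ih r s hr hs hr1 hs1 x hx) hκ.le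
  set q : ℝ := (1 - κ) ^ (N : ℝ)⁻¹ with hq
  have hqN : q ^ N = 1 - κ := Real.rpow_inv_natCast_pow hκ.le hN.ne'
  have hq0 : 0 < q := Real.rpow_pos_of_pos hκ _
  have hq1 : q < 1 := Real.rpow_lt_one hκ.le (by linarith) (by positivity)
  refine ⟨M / (1 - κ), q, by positivity, hq0, hq1, fun u v hu hv hu1 hv1 n x hx => ?_⟩
  have hiter : ∀ w : ℝ → ℝ, T.transfer^[n] w =
      T.transfer^[N * (n / N)] (T.transfer^[n % N] w) := fun w => by
    rw [← Function.iterate_add_apply, Nat.div_add_mod]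
  rw [hiter u, hiter v]
  refine (hmul (n / N) _ _ (h.isDec_iterate_of_le (by linarith) hu hu1 _)
    (h.isDec_iterate_of_le (by linarith) hv hv1 _) ((h.isDec_iterate hu _).2.trans hu1)
    ((h.isDec_iterate hv _).2.trans hv1) x hx).trans ?_
  have hsplit_pow : q ^ n = (1 - κ) ^ (n / N) * q ^ (n % N) := by
    rw [← hqN, ← pow_mul, ← pow_add, Nat.div_add_mod]
  have hle : 1 - κ ≤ q ^ (n % N) := by
    rw [← hqN]
    exact pow_le_pow_of_le_one hq0.le hq1.le (Nat.mod_lt n hN).le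
  rw [hsplit_pow, div_mul_eq_mul_div, le_div_iff₀ hκ, mul_assoc]
  exact mul_le_mul_of_nonneg_left (mul_le_mul_of_nonneg_left hle (by positivity)) hM0.le

/-- Iterates of the transfer operator converge uniformly and exponentially fast to a
nonincreasing density. -/
lemma exists_density (T : PCT) : ∃ (M C q : ℝ) (h : ℝ → ℝ), 0 < C ∧ 0 < q ∧ q < 1 ∧ IsDec M h ∧
    ∫ x in Ioo (0 : ℝ) 1, h x = 1 ∧ ∀ B u, IsDec B u → ∀ n, ∀ x ∈ Ioo (0 : ℝ) 1,
      |T.transfer^[n] u x - (∫ y in Ioo (0 : ℝ) 1, u y) * h x| ≤ C * B * q ^ n := by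
  obtain ⟨α, K, hLY⟩ := T.exists_lasotaYorke
  have hK' : 0 ≤ K / (1 - α) := div_nonneg hLY.2.2.1 (sub_pos.2 hLY.2.1).le
  set M := K / (1 - α) + 2 with hMdef
  obtain ⟨C, q, hC, hq0, hq1, hcontr⟩ := hLY.exists_contraction (M := M) (by linarith)
  set e : ℝ → ℝ := fun _ => 1 with he
  have he1 : ∫ x in Ioo (0 : ℝ) 1, e x = 1 := by simp [he]
  have hedec : IsDec 1 e := IsDec.const zero_le_one
  have heM : IsDec M e := hedec.mono (by linarith)
  have hPM : ∀ m, IsDec M (T.transfer^[m] e) :=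
    hLY.isDec_iterate_of_le (by linarith) heM he1
  have hP1 : ∀ m, ∫ x in Ioo (0 : ℝ) 1, T.transfer^[m] e x = 1 := fun m =>
    (hLY.isDec_iterate heM m).2.trans he1
  have hlim : ∀ x, ∃ l, x ∈ Ioo (0 : ℝ) 1 →
      Tendsto (fun n => T.transfer^[n] e x) atTop (𝓝 l) := by
    intro x
    by_cases hx : x ∈ Ioo (0 : ℝ) 1
    · have hcau : CauchySeq fun n => T.transfer^[n] e x := by
        refine cauchySeq_of_le_geometric q C hq1 fun n => ?_
        exact hcontr e (T.transfer^[1] e) heM (hPM 1) he1 (hP1 1) n x hx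
      obtain ⟨l, hl⟩ := cauchySeq_tendsto_of_complete hcau
      exact ⟨l, fun _ => hl⟩
    · exact ⟨0, fun h => (hx h).elim⟩
  choose h hh using hlim
  have hdec : IsDec M h :=
    ⟨fun x hx y hy hxy => le_of_tendsto_of_tendsto' (hh y hy) (hh x hx)
      fun n => (hPM n).1 hx hy hxy,
      fun x hx => ⟨ge_of_tendsto' (hh x hx) fun n => ((hPM n).2 x hx).1,
        le_of_tendsto' (hh x hx) fun n => ((hPM n).2 x hx).2⟩⟩
  have hconv : ∀ u, IsDec M u → ∫ x in Ioo (0 : ℝ) 1, u x = 1 → ∀ n, ∀ x ∈ Ioo (0 : ℝ) 1,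
      |T.transfer^[n] u x - h x| ≤ C * q ^ n := by
    intro u hu hu1 n x hx
    have ht : Tendsto (fun m => T.transfer^[n] (T.transfer^[m] e) x) atTop (𝓝 (h x)) := by
      simp only [← Function.iterate_add_apply]
      exact (hh x hx).comp (tendsto_add_atTop_nat n |>.congr fun m => add_comm m n)
    exact le_of_tendsto' (tendsto_const_nhds.sub ht).abs
      fun m => hcontr u _ hu (hPM m) hu1 (hP1 m) n x hx
  refine ⟨M, 3 * C, q, h, by positivity, hq0, hq1, hdec, ?_, ?_⟩
  · have hbound : ∀ n : ℕ, |1 - ∫ x in Ioo (0 : ℝ) 1, h x| ≤ C * q ^ n := fun n => by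
      have := abs_setIntegral_Ioo_le (hconv e heM he1 n)
      rwa [integral_sub (hPM n).integrableOn hdec.integrableOn, hP1 n] at this
    have h0 : Tendsto (fun n : ℕ => C * q ^ n) atTop (𝓝 0) := by
      simpa using (tendsto_pow_atTop_nhds_zero_of_lt_one hq0.le hq1).const_mul C
    have := abs_nonpos_iff.1 (ge_of_tendsto' h0 hbound)
    linarith
  · intro B u hu n x hx
    set m := ∫ y in Ioo (0 : ℝ) 1, u y
    have hm0 : 0 ≤ m := hu.integral_nonneg
    have hmB : m ≤ B := hu.integral_le
    rcases hu.bound_nonneg.eq_or_lt with hB | hB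
    · have hPu := (hLY.isDec_iterate hu n).1.abs_le hx
      have hm : m = 0 := by linarith
      simp only [← hB, hm, m] at hPu ⊢
      simpa using hPu
    · have hmB0 : 0 < m + B := by linarith
      set w : ℝ → ℝ := fun x => (m + B)⁻¹ * (u x + B * e x) with hw
      have hudec := hu.add (hedec.const_mul hB.le)
      have hwdec : IsDec M w := (hudec.const_mul (inv_pos.2 hmB0).le).mono (by
        rw [inv_mul_le_iff₀ hmB0]
        nlinarith)
      have hw1 : ∫ x in Ioo (0 : ℝ) 1, w x = 1 := by
        rw [hw, integral_const_mul, integral_add hu.integrableOn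
          (hedec.const_mul hB.le).integrableOn, integral_const_mul, he1, mul_one,
          inv_mul_cancel₀ hmB0.ne']
      have heq : T.transfer^[n] u x =
          (m + B) * T.transfer^[n] w x - B * T.transfer^[n] e x := by
        rw [hw, T.iterate_transfer_const_mul,
          T.iterate_transfer_add hu (hedec.const_mul hB.le), T.iterate_transfer_const_mul,
          mul_inv_cancel_left₀ hmB0.ne']
        ring
      have h1 := hconv w hwdec hw1 n x hx
      have h2 := hconv e heM he1 n x hx
      calc |T.transfer^[n] u x - m * h x|
          = |(m + B) * (T.transfer^[n] w x - h x) - B * (T.transfer^[n] e x - h x)| := by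
            rw [heq]
            ring_nf
        _ ≤ (m + B) * |T.transfer^[n] w x - h x| + B * |T.transfer^[n] e x - h x| := by
            refine (abs_sub _ _).trans (le_of_eq ?_)
            rw [abs_mul, abs_mul, abs_of_pos hmB0, abs_of_pos hB]
        _ ≤ (m + B) * (C * q ^ n) + B * (C * q ^ n) := by gcongr
        _ ≤ 3 * C * B * q ^ n := by
            have : 0 < C * q ^ n := by positivity
            nlinarith

end PCT

namespace PCT

/-- There is a bounded nonincreasing invariant density, to which Lebesgue correlations of
nonincreasing functions against bounded measurable functions converge exponentially fast. -/
lemma exists_invariant_density (T : PCT) : ∃ (M C q : ℝ) (h : ℝ → ℝ),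
    0 < C ∧ 0 < q ∧ q < 1 ∧ IsDec M h ∧ ∫ x in Ioo (0 : ℝ) 1, h x = 1 ∧
    (∀ B G u g, IsDec B u → AEStronglyMeasurable g (volume.restrict (Ioo 0 1)) →
      (∀ x ∈ Icc (0 : ℝ) 1, |g x| ≤ G) → ∀ n,
      |(∫ x in Ioo (0 : ℝ) 1, u x * g (T.τ^[n] x)) -
        (∫ x in Ioo (0 : ℝ) 1, u x) * ∫ x in Ioo (0 : ℝ) 1, h x * g x| ≤
          C * B * q ^ n * G) ∧
    ∀ G g, AEStronglyMeasurable g (volume.restrict (Ioo 0 1)) →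
      (∀ x ∈ Icc (0 : ℝ) 1, |g x| ≤ G) →
      ∫ x in Ioo (0 : ℝ) 1, h x * g (T.τ x) = ∫ x in Ioo (0 : ℝ) 1, h x * g x := by
  obtain ⟨M, C, q, h, hC, hq0, hq1, hdec, hint, hconv⟩ := T.exists_density
  obtain ⟨α, K, hLY⟩ := T.exists_lasotaYorke
  have hdecay : ∀ B G u g, IsDec B u → AEStronglyMeasurable g (volume.restrict (Ioo 0 1)) →
      (∀ x ∈ Icc (0 : ℝ) 1, |g x| ≤ G) → ∀ n,
      |(∫ x in Ioo (0 : ℝ) 1, u x * g (T.τ^[n] x)) -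
        (∫ x in Ioo (0 : ℝ) 1, u x) * ∫ x in Ioo (0 : ℝ) 1, h x * g x| ≤
          C * B * q ^ n * G := by
    intro B G u g hu hg hG n
    have hG' : ∀ x ∈ Ioo (0 : ℝ) 1, |g x| ≤ G := fun x hx => hG x (Ioo_subset_Icc_self hx)
    rw [← T.integral_iterate_transfer_mul hu hg hG, ← integral_const_mul,
      ← integral_sub ((hLY.isDec_iterate hu n).1.integrableOn_mul hg hG')
        ((hdec.integrableOn_mul hg hG').const_mul _)]
    refine abs_setIntegral_Ioo_le fun x hx => ?_
    rw [← mul_assoc, ← sub_mul, abs_mul]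
    exact mul_le_mul (hconv B u hu n x hx) (hG' x hx) (abs_nonneg _)
      (mul_nonneg (mul_nonneg hC.le hu.bound_nonneg) (pow_nonneg hq0.le n))
  refine ⟨M, C, q, h, hC, hq0, hq1, hdec, hint, hdecay, fun G g hg hG => ?_⟩
  have hone : IsDec 1 (fun _ => (1 : ℝ)) := IsDec.const zero_le_one
  have h1 : Tendsto (fun n => ∫ x in Ioo (0 : ℝ) 1, g (T.τ (T.τ^[n] x))) atTop
      (𝓝 (∫ x in Ioo (0 : ℝ) 1, h x * g (T.τ x))) := by
    refine tendsto_iff_dist_tendsto_zero.2 (squeeze_zero (fun _ => dist_nonneg) (fun n => ?_)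
      (g := fun n => C * 1 * q ^ n * G) ?_)
    · simpa [Real.dist_eq] using hdecay 1 G _ (fun x => g (T.τ x)) hone
        (T.aestronglyMeasurable_comp_iterate hg hG 1) (fun x hx => hG _ (T.maps_to hx)) n
    · simpa using ((tendsto_pow_atTop_nhds_zero_of_lt_one hq0.le hq1).const_mul
        (C * 1)).mul_const G
  have h2 : Tendsto (fun n => ∫ x in Ioo (0 : ℝ) 1, g (T.τ^[n] x)) atTop
      (𝓝 (∫ x in Ioo (0 : ℝ) 1, h x * g x)) := by
    refine tendsto_iff_dist_tendsto_zero.2 (squeeze_zero (fun _ => dist_nonneg) (fun n => ?_)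
      (g := fun n => C * 1 * q ^ n * G) ?_)
    · simpa [Real.dist_eq] using hdecay 1 G _ g hone hg hG n
    · simpa using ((tendsto_pow_atTop_nhds_zero_of_lt_one hq0.le hq1).const_mul
        (C * 1)).mul_const G
  refine tendsto_nhds_unique h1 ?_
  simp only [← Function.iterate_succ_apply' T.τ]
  exact h2.comp (tendsto_add_atTop_nat 1)

end PCT

/-! ### Measures on the unit interval with nonincreasing density -/

namespace IsDec

variable {M : ℝ} {h : ℝ → ℝ}

lemma integral_withDensity (hh : IsDec M h) (φ : ℝ → ℝ) :
    ∫ x, φ x ∂((volume.restrict (Ioo (0 : ℝ) 1)).withDensity fun x => ENNReal.ofReal (h x)) =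
      ∫ x in Ioo (0 : ℝ) 1, h x * φ x := by
  rw [integral_withDensity_eq_integral_toReal_smul₀
    hh.aestronglyMeasurable.aemeasurable.ennreal_ofReal
    (ae_of_all _ fun _ => ENNReal.ofReal_lt_top)]
  refine setIntegral_congr_fun measurableSet_Ioo fun x hx => ?_
  simp only [ENNReal.toReal_ofReal (hh.2 x hx).1, smul_eq_mul]

lemma isProbabilityMeasure_withDensity (hh : IsDec M h)
    (h1 : ∫ x in Ioo (0 : ℝ) 1, h x = 1) : IsProbabilityMeasure
      ((volume.restrict (Ioo (0 : ℝ) 1)).withDensity fun x => ENNReal.ofReal (h x)) := by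
  refine ⟨?_⟩
  rw [withDensity_apply _ MeasurableSet.univ, Measure.restrict_univ,
    ← ofReal_integral_eq_lintegral_ofReal hh.integrableOn
    ((ae_restrict_iff' measurableSet_Ioo).2 (ae_of_all _ fun x hx => (hh.2 x hx).1)), h1,
    ENNReal.ofReal_one]

end IsDec

/-- A measure which integrates `1_A ∘ φ` and `1_A` alike is invariant under `φ`. -/
lemma measure_preimage_eq_of_integral_indicator {ν : Measure ℝ} [IsFiniteMeasure ν] {φ : ℝ → ℝ}
    {A : Set ℝ} (hA : MeasurableSet A)
    (hφ : AEStronglyMeasurable (fun x => A.indicator (fun _ => (1 : ℝ)) (φ x)) ν)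
    (h : ∫ x, A.indicator (fun _ => (1 : ℝ)) (φ x) ∂ν = ∫ x, A.indicator (fun _ => (1 : ℝ)) x ∂ν) :
    ν (φ ⁻¹' A) = ν A := by
  have hind : (fun x => A.indicator (fun _ => (1 : ℝ)) (φ x)) =
      (φ ⁻¹' A).indicator fun _ => (1 : ℝ) := rfl
  rw [hind] at hφ
  have hnull : NullMeasurableSet (φ ⁻¹' A) ν :=
    (aemeasurable_indicator_const_iff (1 : ℝ)).1 hφ.aemeasurable
  rw [hind, integral_indicator₀ hnull, integral_indicator hA] at h
  simpa [Measure.real, ENNReal.toReal_eq_toReal_iff'] using h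

/-! ### Functions of bounded variation -/

namespace BoundedVariationOn

variable {f : ℝ → ℝ}

lemma integrableOn_Icc (hf : BoundedVariationOn f (Icc 0 1)) :
    IntegrableOn f (Icc 0 1) := by
  obtain ⟨p, r, hp, hr, hpr⟩ := hf.locallyBoundedVariationOn.exists_monotoneOn_sub_monotoneOn
  rw [hpr]
  exact (hp.integrableOn_isCompact isCompact_Icc).sub (hr.integrableOn_isCompact isCompact_Icc)

lemma abs_le_integral_add_eVariationOn (hf : BoundedVariationOn f (Icc 0 1)) {x : ℝ}
    (hx : x ∈ Icc (0 : ℝ) 1) :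
    |f x| ≤ (∫ y in Icc (0 : ℝ) 1, |f y|) + (eVariationOn f (Icc (0 : ℝ) 1)).toReal := by
  have h : ∫ _ in Icc (0 : ℝ) 1, (|f x| - (eVariationOn f (Icc (0 : ℝ) 1)).toReal) ≤
      ∫ y in Icc (0 : ℝ) 1, |f y| := by
    refine setIntegral_mono_on (integrableOn_const (by simp)) hf.integrableOn_Icc.abs
      measurableSet_Icc fun y hy => ?_
    have h1 := hf.dist_le hx hy
    rw [Real.dist_eq] at h1
    linarith [abs_sub_abs_le_abs_sub (f x) (f y)]
  simp at h
  linarith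

/-- Quantitative Jordan decomposition into nonincreasing functions. -/
lemma exists_isDec_sub_isDec (hf : BoundedVariationOn f (Icc 0 1)) {F : ℝ}
    (hF : F = (∫ y in Icc (0 : ℝ) 1, |f y|) + (eVariationOn f (Icc (0 : ℝ) 1)).toReal) :
    ∃ u v, IsDec (3 * F) u ∧ IsDec (3 * F) v ∧ ∀ x ∈ Ioo (0 : ℝ) 1, f x = u x - v x := by
  set V := (eVariationOn f (Icc (0 : ℝ) 1)).toReal
  set p := variationOnFromTo f (Icc (0 : ℝ) 1) 0
  have hVF : V ≤ F := by
    rw [hF]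
    exact le_add_of_nonneg_left (integral_nonneg fun _ => abs_nonneg _)
  have hfF : ∀ x ∈ Icc (0 : ℝ) 1, |f x| ≤ F := fun x hx =>
    hF ▸ hf.abs_le_integral_add_eVariationOn hx
  have h0 : (0 : ℝ) ∈ Icc (0 : ℝ) 1 := by simp
  have hpmono : MonotoneOn p (Icc 0 1) :=
    variationOnFromTo.monotoneOn hf.locallyBoundedVariationOn h0
  have hpfmono : MonotoneOn (p - f) (Icc 0 1) :=
    variationOnFromTo.sub_self_monotoneOn hf.locallyBoundedVariationOn h0
  have hp : ∀ x ∈ Icc (0 : ℝ) 1, p x ∈ Icc 0 V := fun x hx => by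
    refine ⟨variationOnFromTo.nonneg_of_le f _ hx.1, ?_⟩
    rw [show p x = _ from variationOnFromTo.eq_of_le f _ hx.1]
    exact ENNReal.toReal_mono hf (eVariationOn.mono f inter_subset_left)
  have hsub : Ioo (0 : ℝ) 1 ⊆ Icc 0 1 := Ioo_subset_Icc_self
  refine ⟨fun x => V + F - (p - f) x, fun x => V + F - p x,
    ⟨fun x hx y hy hxy => sub_le_sub_left (hpfmono (hsub hx) (hsub hy) hxy) _, fun x hx => ?_⟩,
    ⟨fun x hx y hy hxy => sub_le_sub_left (hpmono (hsub hx) (hsub hy) hxy) _, fun x hx => ?_⟩,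
    fun x _ => ?_⟩
  · have h1 := hp x (hsub hx)
    have h2 := _root_.abs_le.1 (hfF x (hsub hx))
    simp only [Pi.sub_apply]
    constructor <;> linarith [h1.1, h1.2]
  · have h1 := hp x (hsub hx)
    have h2 := (abs_nonneg _).trans (hfF x (hsub hx))
    constructor <;> linarith [h1.1, h1.2]
  · simp only [Pi.sub_apply]
    ring

end BoundedVariationOn

/-- exponential decay of correlations. Let `τ ∈ 𝒯` with unique
absolutely continuous invariant probability measure `μ`. Then there are `C > 0` and
`0 < q < 1` such that for all `f, g` of bounded variation on `I` and all `n ∈ ℕ`,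
`|∫ f·(g∘τⁿ) dμ − (∫ f dμ)(∫ g dμ)| ≤ C·‖f‖_BV·‖g‖_BV·qⁿ`, where
`‖u‖_BV = ‖u‖₁ + var_I u`. -/
theorem exponential_decay_of_correlations (T : PCT) (μ : MeasureTheory.Measure ℝ)
    (hμp : MeasureTheory.IsProbabilityMeasure μ) (hac : μ ≪ volume)
    (hsupp : μ (Set.Icc (0:ℝ) 1)ᶜ = 0)
    (hinv : ∀ A : Set ℝ, MeasurableSet A →
      μ (T.τ ⁻¹' A ∩ Set.Icc 0 1) = μ (A ∩ Set.Icc 0 1))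
    (huniq : ∀ ν : MeasureTheory.Measure ℝ, MeasureTheory.IsProbabilityMeasure ν →
      ν ≪ volume → ν (Set.Icc (0:ℝ) 1)ᶜ = 0 →
      (∀ A : Set ℝ, MeasurableSet A →
        ν (T.τ ⁻¹' A ∩ Set.Icc 0 1) = ν (A ∩ Set.Icc 0 1)) → ν = μ) :
    ∃ C q : ℝ, 0 < C ∧ 0 < q ∧ q < 1 ∧
      ∀ f g : ℝ → ℝ, BoundedVariationOn f (Set.Icc (0:ℝ) 1) →
        BoundedVariationOn g (Set.Icc (0:ℝ) 1) →
      ∀ n : ℕ,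
        |(∫ x, f x * g (T.τ^[n] x) ∂μ) - (∫ x, f x ∂μ) * (∫ x, g x ∂μ)| ≤
          C * ((∫ x in Set.Icc (0:ℝ) 1, |f x|) +
              (eVariationOn f (Set.Icc (0:ℝ) 1)).toReal) *
            ((∫ x in Set.Icc (0:ℝ) 1, |g x|) +
              (eVariationOn g (Set.Icc (0:ℝ) 1)).toReal) * q ^ n := by
  obtain ⟨M, C, q, h, hC, hq0, hq1, hdec, hint, hdecay, hhinv⟩ := T.exists_invariant_density
  have hM : 0 < M := by linarith [hdec.integral_le]
  have hμ : (volume.restrict (Ioo (0 : ℝ) 1)).withDensity (fun x => ENNReal.ofReal (h x)) = μ := by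
    set ν := (volume.restrict (Ioo (0 : ℝ) 1)).withDensity (fun x => ENNReal.ofReal (h x)) with hν
    have hνp : IsProbabilityMeasure ν := hdec.isProbabilityMeasure_withDensity hint
    have hνac : ν ≪ volume.restrict (Ioo (0 : ℝ) 1) := withDensity_absolutelyContinuous _ _
    have hνsupp : ν (Icc (0 : ℝ) 1)ᶜ = 0 := by
      refine hνac ?_
      rw [Measure.restrict_apply measurableSet_Icc.compl,
        (disjoint_compl_left.mono_right Ioo_subset_Icc_self).inter_eq, measure_empty]
    refine huniq ν hνp (hνac.trans Measure.restrict_le_self.absolutelyContinuous) hνsupp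
      fun A hA => ?_
    rw [measure_inter_conull hνsupp, measure_inter_conull hνsupp]
    have hg : AEStronglyMeasurable (A.indicator fun _ => (1 : ℝ))
        (volume.restrict (Ioo (0 : ℝ) 1)) :=
      (measurable_const.indicator hA).aestronglyMeasurable
    have hg1 : ∀ x ∈ Icc (0 : ℝ) 1, |A.indicator (fun _ => (1 : ℝ)) x| ≤ 1 := fun x _ => by
      by_cases hx : x ∈ A <;> simp [hx]
    refine measure_preimage_eq_of_integral_indicator hA
      ((T.aestronglyMeasurable_comp_iterate hg hg1 1).mono_ac hνac) ?_
    rw [hdec.integral_withDensity, hdec.integral_withDensity]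
    exact hhinv 1 _ hg hg1
  refine ⟨6 * M * C, q, by positivity, hq0, hq1, fun f g hf hg n => ?_⟩
  obtain ⟨F, hF⟩ : ∃ F, F = (∫ x in Icc (0 : ℝ) 1, |f x|) +
    (eVariationOn f (Icc (0 : ℝ) 1)).toReal := ⟨_, rfl⟩
  obtain ⟨G, hG⟩ : ∃ G, G = (∫ x in Icc (0 : ℝ) 1, |g x|) +
    (eVariationOn g (Icc (0 : ℝ) 1)).toReal := ⟨_, rfl⟩
  rw [← hF, ← hG]
  have hgG : ∀ x ∈ Icc (0 : ℝ) 1, |g x| ≤ G := fun x hx =>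
    hG ▸ hg.abs_le_integral_add_eVariationOn hx
  have hgm : AEStronglyMeasurable g (volume.restrict (Ioo 0 1)) :=
    (hg.integrableOn_Icc.mono_set Ioo_subset_Icc_self).aestronglyMeasurable
  obtain ⟨u, v, hu, hv, huv⟩ := hf.exists_isDec_sub_isDec hF
  have hhu := hdec.mul hu
  have hhv := hdec.mul hv
  have hgn := T.aestronglyMeasurable_comp_iterate hgm hgG n
  have hgnG : ∀ x ∈ Ioo (0 : ℝ) 1, |g (T.τ^[n] x)| ≤ G := fun x hx =>
    hgG _ (T.maps_to.iterate n (Ioo_subset_Icc_self hx))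
  have h1 : ∫ x, f x * g (T.τ^[n] x) ∂μ =
      (∫ x in Ioo (0 : ℝ) 1, h x * u x * g (T.τ^[n] x)) -
        ∫ x in Ioo (0 : ℝ) 1, h x * v x * g (T.τ^[n] x) := by
    rw [← hμ, hdec.integral_withDensity, ← integral_sub (hhu.integrableOn_mul hgn hgnG)
      (hhv.integrableOn_mul hgn hgnG)]
    refine setIntegral_congr_fun measurableSet_Ioo fun x hx => ?_
    simp only [huv x hx]
    ring
  have h2 : ∫ x, f x ∂μ =
      (∫ x in Ioo (0 : ℝ) 1, h x * u x) - ∫ x in Ioo (0 : ℝ) 1, h x * v x := by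
    rw [← hμ, hdec.integral_withDensity, ← integral_sub hhu.integrableOn hhv.integrableOn]
    refine setIntegral_congr_fun measurableSet_Ioo fun x hx => ?_
    simp only [huv x hx]
    ring
  have h3 : ∫ x, g x ∂μ = ∫ x in Ioo (0 : ℝ) 1, h x * g x := by
    rw [← hμ, hdec.integral_withDensity]
  have h4 := hdecay _ G _ g hhu hgm hgG n
  have h5 := hdecay _ G _ g hhv hgm hgG n
  rw [h1, h2, h3, sub_mul, sub_sub_sub_comm]
  refine (abs_sub _ _).trans ((add_le_add h4 h5).trans (le_of_eq ?_))
  ring
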